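/- arXiv:0911.2317 — 3 statements merged into one kernel-verified Lean document; each statement's English description precedes it below -/
import Mathlib

section
/- Let ε ∈ (0,1) and let m ≥ 2 be an integer, and set t = ⌈(2/ε)·ln(2m)⌉. Then there exists a set of parameters K = {k_1, …, k_t} ⊆ {0, 1, …, m−1} that is "good" for every integer b not divisible by m; that is, for every integer b with b ≢ 0 (mod m), (1/t²)·(Σ_{i=1}^t cos(2π k_i b / m))² < ε. -/
theorem sum_exp_mul_le {ι : Type*} [Fintype ι] (x : ι → ℝ) (hx : ∀ i, |x i| ≤ 1)
    (hsum : ∑ i, x i = 0) (s : ℝ) :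
    ∑ i, Real.exp (s * x i) ≤ Fintype.card ι * Real.exp (s ^ 2 / 2) := by
  have key : ∀ i, Real.exp (s * x i) ≤ Real.cosh s + x i * Real.sinh s := by
    intro i
    obtain ⟨h1, h2⟩ := abs_le.mp (hx i)
    have h := convexOn_exp.2 (Set.mem_univ s) (Set.mem_univ (-s))
      (by linarith : 0 ≤ (1 + x i) / 2) (by linarith : 0 ≤ (1 - x i) / 2) (by ring)
    simp only [smul_eq_mul] at h
    rw [Real.cosh_eq, Real.sinh_eq]
    calc Real.exp (s * x i)
        = Real.exp ((1 + x i) / 2 * s + (1 - x i) / 2 * -s) := by congr 1; ring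
      _ ≤ _ := h
      _ = _ := by ring
  calc ∑ i, Real.exp (s * x i) ≤ ∑ i, (Real.cosh s + x i * Real.sinh s) :=
        Finset.sum_le_sum fun i _ => key i
    _ = Fintype.card ι * Real.cosh s := by
        rw [Finset.sum_add_distrib, ← Finset.sum_mul, hsum]
        simp
    _ ≤ _ := by gcongr; exact Real.cosh_le_exp_half_sq s

theorem sum_exp_mul_sum_le {ι : Type*} [Fintype ι] (x : ι → ℝ)
    (hx : ∀ i, |x i| ≤ 1) (hsum : ∑ i, x i = 0) (s : ℝ) (t : ℕ) :
    ∑ k : Fin t → ι, Real.exp (s * ∑ i, x (k i)) ≤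
      (Fintype.card ι : ℝ) ^ t * Real.exp (s ^ 2 * t / 2) := by
  have h : ∑ k : Fin t → ι, Real.exp (s * ∑ i, x (k i)) = (∑ j, Real.exp (s * x j)) ^ t := by
    rw [Fintype.sum_pow]
    exact Finset.sum_congr rfl fun k _ => by rw [Finset.mul_sum, Real.exp_sum]
  rw [h]
  calc _ ≤ (Fintype.card ι * Real.exp (s ^ 2 / 2)) ^ t :=
        pow_le_pow_left₀ (Finset.sum_nonneg fun _ _ => (Real.exp_pos _).le)
          (sum_exp_mul_le x hx hsum s) t
    _ = _ := by
        rw [mul_pow, ← Real.exp_nat_mul]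
        congr 2
        ring

theorem sum_cos_two_pi_mul_div_eq_zero {m : ℕ} (hm : m ≠ 0) {b : ℤ} (hb : ¬ (m : ℤ) ∣ b) :
    ∑ k : Fin m, Real.cos (2 * Real.pi * ((k : ℕ) : ℝ) * (b : ℝ) / (m : ℝ)) = 0 := by
  have hmC : (m : ℂ) ≠ 0 := by exact_mod_cast hm
  set z : ℂ := Complex.exp (2 * Real.pi * Complex.I * b / m) with hz
  have hz1 : z ≠ 1 := by
    intro h
    obtain ⟨n, hn⟩ := Complex.exp_eq_one_iff.mp h
    apply hb
    refine ⟨n, ?_⟩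
    have h2 : (2 * Real.pi * Complex.I : ℂ) ≠ 0 := Complex.two_pi_I_ne_zero
    field_simp at hn
    have : (b : ℂ) = m * n := by
      apply mul_left_cancel₀ h2
      linear_combination (2 * Real.pi * Complex.I : ℂ) * hn
    exact_mod_cast this
  have hzm : z ^ m = 1 := by
    rw [hz, ← Complex.exp_nat_mul, Complex.exp_eq_one_iff]
    exact ⟨b, by field_simp⟩
  have hgeom : ∑ k ∈ Finset.range m, z ^ k = 0 := by
    rw [geom_sum_eq hz1, hzm, sub_self, zero_div]
  rw [Fin.sum_univ_eq_sum_range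
    (fun k : ℕ => Real.cos (2 * Real.pi * (k : ℝ) * (b : ℝ) / (m : ℝ))) m]
  have hre := congrArg Complex.re hgeom
  rw [Complex.re_sum, Complex.zero_re] at hre
  rw [← hre]
  refine Finset.sum_congr rfl fun k _ => ?_
  rw [hz, ← Complex.exp_nat_mul, ← Complex.exp_ofReal_mul_I_re]
  congr 2
  push_cast
  ring

theorem cos_two_pi_mul_emod_div {m : ℕ} (hm : m ≠ 0) (k : ℕ) (b : ℤ) :
    Real.cos (2 * Real.pi * (k : ℝ) * ((b % m : ℤ) : ℝ) / (m : ℝ)) =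
      Real.cos (2 * Real.pi * (k : ℝ) * (b : ℝ) / (m : ℝ)) := by
  have hmR : (m : ℝ) ≠ 0 := by exact_mod_cast hm
  have hb : (b : ℝ) = ((b % m : ℤ) : ℝ) + m * ((b / m : ℤ) : ℝ) := by
    exact_mod_cast (Int.emod_add_mul_ediv b m).symm
  rw [← Real.cos_add_int_mul_two_pi _ (k * (b / m))]
  congr 1
  rw [hb]
  push_cast
  field_simp

/-- If finitely many centred functions on `ι` are bounded by `1`, some `t`-tuple keeps all of
their exponential moments at most their averages over `ι ^ t`. -/
theorem exists_sum_exp_le {ι β : Type*} [Fintype ι] [Nonempty ι] (B : Finset β)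
    (x : β → ι → ℝ) (hx : ∀ b ∈ B, ∀ i, |x b i| ≤ 1) (hsum : ∀ b ∈ B, ∑ i, x b i = 0)
    (s : ℝ) (t : ℕ) :
    ∃ k : Fin t → ι,
      ∑ b ∈ B, (Real.exp (s * ∑ i, x b (k i)) + Real.exp (-s * ∑ i, x b (k i))) ≤
        2 * B.card * Real.exp (s ^ 2 * t / 2) := by
  have htotal : ∑ k : Fin t → ι,
      ∑ b ∈ B, (Real.exp (s * ∑ i, x b (k i)) + Real.exp (-s * ∑ i, x b (k i))) ≤
        ∑ _k : Fin t → ι, 2 * B.card * Real.exp (s ^ 2 * t / 2) := by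
    rw [Finset.sum_comm]
    calc _ ≤ ∑ _b ∈ B, 2 * ((Fintype.card ι : ℝ) ^ t * Real.exp (s ^ 2 * t / 2)) := by
          refine Finset.sum_le_sum fun b hb => ?_
          rw [Finset.sum_add_distrib, two_mul]
          refine add_le_add (sum_exp_mul_sum_le _ (hx b hb) (hsum b hb) s t) ?_
          simpa only [neg_sq] using sum_exp_mul_sum_le _ (hx b hb) (hsum b hb) (-s) t
      _ = _ := by
          simp only [Finset.sum_const, nsmul_eq_mul, Finset.card_univ, Fintype.card_pi,
            Finset.prod_const, Fintype.card_fin, Nat.cast_pow]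
          ring
  obtain ⟨k, -, hk⟩ := Finset.exists_le_of_sum_le Finset.univ_nonempty htotal
  exact ⟨k, hk⟩

/-- There exists a set of parameters `K = {k_1, …, k_t} ⊆ {0, …, m-1}`, with
`t = ⌈(2/ε)·ln(2m)⌉`, that is "good" for every integer `b` not divisible by `m`:
`(1/t²)·(Σ_i cos(2π k_i b / m))² < ε`. -/
theorem exists_good_set (ε : ℝ) (hε : ε ∈ Set.Ioo (0 : ℝ) 1) (m : ℕ) (hm : 2 ≤ m)
    (t : ℕ) (ht : t = ⌈(2 / ε) * Real.log (2 * m)⌉₊) :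
    ∃ k : Fin t → ℕ, (∀ i, k i < m) ∧
      ∀ b : ℤ, ¬ ((m : ℤ) ∣ b) →
        (1 / (t : ℝ) ^ 2) *
          (∑ i, Real.cos (2 * Real.pi * (k i : ℝ) * (b : ℝ) / (m : ℝ))) ^ 2 < ε := by
  obtain ⟨hε0, -⟩ := hε
  have hm0 : m ≠ 0 := by omega
  have hmR : (2 : ℝ) ≤ m := by exact_mod_cast hm
  have : NeZero m := ⟨hm0⟩
  have htlog : Real.log (2 * m) ≤ ε * t / 2 := by
    have h : (2 / ε) * Real.log (2 * m) ≤ t := ht ▸ Nat.le_ceil _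
    calc Real.log (2 * m) = ε / 2 * ((2 / ε) * Real.log (2 * m)) := by field_simp
      _ ≤ ε / 2 * t := by gcongr
      _ = _ := by ring
  have hexp : 2 * (m : ℝ) ≤ Real.exp (ε * t / 2) :=
    (Real.log_le_iff_le_exp (by positivity)).mp htlog
  have htpos : (0 : ℝ) < t := by
    have : 0 < Real.log (2 * m) := Real.log_pos (by linarith)
    by_contra! h
    nlinarith
  set B : Finset ℤ := Finset.Ioo 0 (m : ℤ) with hB
  have hBcard : (B.card : ℝ) = m - 1 := by
    rw [hB, Int.card_Ioo, ← Nat.cast_pred (by omega : 0 < m)]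
    congr 1
    omega
  obtain ⟨k, hk⟩ := exists_sum_exp_le B
    (fun b (j : Fin m) => Real.cos (2 * Real.pi * ((j : ℕ) : ℝ) * (b : ℝ) / (m : ℝ)))
    (fun b _ j => Real.abs_cos_le_one _)
    (fun b hb => sum_cos_two_pi_mul_div_eq_zero hm0 fun hdvd => by
      rw [hB, Finset.mem_Ioo] at hb
      exact absurd (Int.le_of_dvd hb.1 hdvd) (by omega))
    (√ε) t
  rw [Real.sq_sqrt hε0.le, hBcard] at hk
  refine ⟨fun i => k i, fun i => (k i).isLt, fun b hb => ?_⟩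
  have hbB : b % m ∈ B := by
    rw [hB, Finset.mem_Ioo]
    have h0 := Int.emod_nonneg b (by omega : (m : ℤ) ≠ 0)
    have h1 := Int.emod_lt_of_pos b (by omega : (0 : ℤ) < m)
    have h2 : b % m ≠ 0 := fun h => hb (Int.dvd_of_emod_eq_zero h)
    omega
  have hle := (Finset.single_le_sum (fun c _ => by positivity) hbB).trans hk
  simp only [cos_two_pi_mul_emod_div hm0] at hle
  set S : ℝ := ∑ i, Real.cos (2 * Real.pi * ((k i : ℕ) : ℝ) * (b : ℝ) / (m : ℝ)) with hS
  by_contra! hbad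
  have hsq : (√ε * t) ^ 2 ≤ S ^ 2 := by
    rw [mul_pow, Real.sq_sqrt hε0.le]
    rw [one_div, inv_mul_eq_div, le_div_iff₀ (by positivity)] at hbad
    exact hbad
  have habs : √ε * t ≤ |S| := by
    rw [← abs_of_nonneg (by positivity : 0 ≤ √ε * t)]
    exact sq_le_sq.mp hsq
  have hεt : ε * t ≤ √ε * |S| := by
    calc ε * t = √ε * (√ε * t) := by rw [← mul_assoc, Real.mul_self_sqrt hε0.le]
      _ ≤ _ := by gcongr
  have hlow : Real.exp (ε * t) ≤ Real.exp (√ε * S) + Real.exp (-√ε * S) := by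
    refine (Real.exp_le_exp.mpr hεt).trans ?_
    rcases abs_cases S with ⟨h, -⟩ | ⟨h, -⟩ <;> rw [h]
    · linarith [Real.exp_pos (-√ε * S)]
    · rw [mul_neg, ← neg_mul]
      linarith [Real.exp_pos (√ε * S)]
  have hsplit : Real.exp (ε * t) = Real.exp (ε * t / 2) * Real.exp (ε * t / 2) := by
    rw [← Real.exp_add, add_halves]
  rw [hsplit] at hlow
  have := le_of_mul_le_mul_right (hlow.trans hle) (Real.exp_pos _)
  linarith
end

section
/- Let n ≥ 1 and let x = (x_{ij})_{1≤i,j≤n} be an n×n matrix with entries in {0,1}. Then the congruence Σ_{i=1}^n Σ_{j=1}^n x_{ij}·((n+1)^{i−1} + (n+1)^{n+j−1}) ≡ Σ_{i=1}^{2n} (n+1)^{i−1} (mod (n+1)^{2n}) holds if and only if x is a permutation matrix, i.e., every row of x contains exactly one 1 and every column of x contains exactly one 1. Equivalently, the linear polynomial Σ_{i=1}^n Σ_{j=1}^n x_{ij}((n+1)^{i−1}+(n+1)^{n+j−1}) − Σ_{i=1}^{2n}(n+1)^{i−1} over Z_{(n+1)^{2n}} is a characteristic polynomial of the Permutation-Matrix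 test function PERM_n. -/
open Finset in
/-- A vector of signed digits of absolute value less than `B` that represents `0` modulo `B ^ m`
is zero. -/
theorem eq_zero_of_pow_dvd_sum_mul_pow {B : ℤ} (m : ℕ) (d : Fin m → ℤ) (hd : ∀ k, |d k| < B)
    (h : B ^ m ∣ ∑ k, d k * B ^ (k : ℕ)) (k : Fin m) : d k = 0 := by
  induction m with
  | zero => exact k.elim0
  | succ m ih =>
    have hB : B ≠ 0 := ((abs_nonneg _).trans_lt (hd 0)).ne'
    have hsum : ∑ k, d k * B ^ (k : ℕ) = d 0 + B * ∑ k : Fin m, d k.succ * B ^ (k : ℕ) := by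
      rw [Fin.sum_univ_succ, mul_sum]
      simp only [Fin.val_zero, pow_zero, mul_one, Fin.val_succ, pow_succ]
      congr 1
      exact sum_congr rfl fun _ _ => by ring
    rw [hsum] at h
    have h0 : d 0 = 0 := by
      have hdvd : B ∣ d 0 :=
        (dvd_add_left (dvd_mul_right B _)).1 ((dvd_pow_self B m.succ_ne_zero).trans h)
      exact Int.eq_zero_of_abs_lt_dvd hdvd (hd 0)
    rw [h0, zero_add, pow_succ', mul_dvd_mul_iff_left hB] at h
    exact Fin.cases h0 (ih (fun k => d k.succ) (fun k => hd k.succ) h) k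

/-- A vector of digits in `[0, n]` represents `∑ k < m, (n + 1) ^ k` modulo `(n + 1) ^ m`
if and only if all its digits are `1`. -/
theorem sum_mul_pow_modEq_sum_pow_iff {n : ℕ} (hn : 1 ≤ n) {m : ℕ} (d : Fin m → ℤ)
    (h0 : ∀ k, 0 ≤ d k) (h1 : ∀ k, d k ≤ n) :
    (∑ k, d k * ((n : ℤ) + 1) ^ (k : ℕ)) ≡ ∑ k ∈ Finset.range m, ((n : ℤ) + 1) ^ k
      [ZMOD ((n : ℤ) + 1) ^ m] ↔ ∀ k, d k = 1 := by
  rw [Finset.sum_range]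
  refine ⟨fun h k => ?_, fun h => by simp [h, Int.ModEq.refl]⟩
  have hdvd := h.symm.dvd
  rw [← Finset.sum_sub_distrib] at hdvd
  have := eq_zero_of_pow_dvd_sum_mul_pow (B := (n : ℤ) + 1) m (fun k => d k - 1)
    (fun k => by rw [abs_lt]; have := h0 k; have := h1 k; constructor <;> omega)
    (by simpa only [sub_mul, one_mul] using hdvd) k
  exact sub_eq_zero.1 this

theorem sum_ite_eq_one_iff_existsUnique {α : Type*} [Fintype α] (p : α → Bool) :
    ∑ a, (if p a then (1 : ℤ) else 0) = 1 ↔ ∃! a, p a = true := by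
  rw [Finset.sum_boole, Nat.cast_eq_one, Finset.card_eq_one, Finset.singleton_iff_unique_mem]
  simp

theorem sum_ite_nonneg_and_le_card {α : Type*} [Fintype α] (p : α → Bool) :
    0 ≤ ∑ a, (if p a then (1 : ℤ) else 0) ∧
      ∑ a, (if p a then (1 : ℤ) else 0) ≤ Fintype.card α := by
  rw [Finset.sum_boole]
  exact ⟨Nat.cast_nonneg _, Nat.cast_le.2 (Finset.card_le_univ _)⟩


/-- The congruence `Σ_i Σ_j x_{ij}((n+1)^{i-1} + (n+1)^{n+j-1}) ≡ Σ_{i=1}^{2n} (n+1)^{i-1}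
(mod (n+1)^{2n})` holds iff the 0/1 matrix `x` is a permutation matrix: the corresponding
linear polynomial over `Z_{(n+1)^{2n}}` is a characteristic polynomial of `PERM_n`. -/
theorem perm_characteristic_polynomial (n : ℕ) (hn : 1 ≤ n) (x : Fin n → Fin n → Bool) :
    (∑ i : Fin n, ∑ j : Fin n, (if x i j then (1 : ℤ) else 0) *
        (((n : ℤ) + 1) ^ (i : ℕ) + ((n : ℤ) + 1) ^ (n + (j : ℕ)))) ≡
      (∑ i ∈ Finset.range (2 * n), ((n : ℤ) + 1) ^ i) [ZMOD (((n : ℤ) + 1) ^ (2 * n))] ↔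
    ((∀ i : Fin n, ∃! j : Fin n, x i j = true) ∧
      (∀ j : Fin n, ∃! i : Fin n, x i j = true)) := by
  set r : Fin n → ℤ := fun i => ∑ j, if x i j then (1 : ℤ) else 0 with hr
  set c : Fin n → ℤ := fun j => ∑ i, if x i j then (1 : ℤ) else 0 with hc
  have hsum : (∑ i : Fin n, ∑ j : Fin n, (if x i j then (1 : ℤ) else 0) *
      (((n : ℤ) + 1) ^ (i : ℕ) + ((n : ℤ) + 1) ^ (n + (j : ℕ)))) =
      ∑ k : Fin (n + n), Fin.append r c k * ((n : ℤ) + 1) ^ (k : ℕ) := by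
    simp only [mul_add, Finset.sum_add_distrib, Fin.sum_univ_add, Fin.append_left,
      Fin.append_right, Fin.val_castAdd, Fin.val_natAdd, hr, hc, Finset.sum_mul]
    congr 1
    exact Finset.sum_comm
  have hbound : ∀ k, 0 ≤ Fin.append r c k ∧ Fin.append r c k ≤ n := by
    intro k
    refine Fin.addCases (fun i => ?_) (fun j => ?_) k
    · simpa only [Fin.append_left, Fintype.card_fin] using sum_ite_nonneg_and_le_card (x i)
    · simpa only [Fin.append_right, Fintype.card_fin] using
        sum_ite_nonneg_and_le_card fun i => x i j
  rw [hsum, two_mul, sum_mul_pow_modEq_sum_pow_iff hn _ (fun k => (hbound k).1)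
    (fun k => (hbound k).2), Fin.forall_fin_add]
  simp only [Fin.append_left, Fin.append_right, hr, hc]
  exact and_congr (forall_congr' fun i => sum_ite_eq_one_iff_existsUnique (x i))
    (forall_congr' fun j => sum_ite_eq_one_iff_existsUnique fun i => x i j)
end

section
/- Let ε ∈ (0,1), let m ≥ 2 and t ≥ 1 be integers, and let K = {k_1,…,k_t} be a set of integers that is "good" for every integer b with b ≢ 0 (mod m), i.e., (1/t²)·(Σ_{i=1}^t cos(2π k_i b/m))² < ε for every such b. Let g_1, …, g_l be integers such that g_j ≢ 0 (mod m) for at least one index j. Then (1/t)·Σ_{i=1}^t ∏_{j=1}^l cos²(π k_i g_j / m) ≤ 1/2 + √ε/2. -/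
/-- Acceptance-probability bound for the generalized fingerprinting technique: if `K` is
"good" for every `b ≢ 0 (mod m)` and some `g_j ≢ 0 (mod m)`, then
`(1/t)·Σ_i ∏_j cos²(π k_i g_j / m) ≤ 1/2 + √ε/2`. -/
theorem generalized_fingerprinting_bound (ε : ℝ) (hε : ε ∈ Set.Ioo (0 : ℝ) 1)
    (m : ℕ) (hm : 2 ≤ m) (t : ℕ) (ht : 1 ≤ t) (k : Fin t → ℤ)
    (hgood : ∀ b : ℤ, ¬ ((m : ℤ) ∣ b) →
      (1 / (t : ℝ) ^ 2) *
        (∑ i, Real.cos (2 * Real.pi * (k i : ℝ) * (b : ℝ) / (m : ℝ))) ^ 2 < ε)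
    (l : ℕ) (g : Fin l → ℤ) (hg : ∃ j, ¬ ((m : ℤ) ∣ g j)) :
    (1 / (t : ℝ)) *
        ∑ i, ∏ j, (Real.cos (Real.pi * (k i : ℝ) * (g j : ℝ) / (m : ℝ))) ^ 2 ≤
      1 / 2 + Real.sqrt ε / 2 := by
  obtain ⟨j₀, hj₀⟩ := hg
  have ht0 : (0 : ℝ) < t := by exact_mod_cast ht
  set S := ∑ i, Real.cos (2 * Real.pi * (k i : ℝ) * (g j₀ : ℝ) / (m : ℝ)) with hS
  have hmean : S / t ≤ Real.sqrt ε := by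
    apply Real.le_sqrt_of_sq_le
    have h := hgood (g j₀) hj₀
    rw [← hS, one_div_mul_eq_div, ← div_pow] at h
    exact h.le
  have hterm : ∀ i, ∏ j, (Real.cos (Real.pi * (k i : ℝ) * (g j : ℝ) / (m : ℝ))) ^ 2 ≤
      1 / 2 + Real.cos (2 * Real.pi * (k i : ℝ) * (g j₀ : ℝ) / (m : ℝ)) / 2 := by
    intro i
    rw [← Finset.mul_prod_erase _ _ (Finset.mem_univ j₀)]
    refine (mul_le_of_le_one_right (sq_nonneg _) (Finset.prod_le_one
      (fun _ _ => sq_nonneg _) fun _ _ => Real.cos_sq_le_one _)).trans_eq ?_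
    rw [Real.cos_sq]
    ring_nf
  have hsum := Finset.sum_le_sum fun i (_ : i ∈ Finset.univ) => hterm i
  rw [Finset.sum_add_distrib, ← Finset.sum_div, ← Finset.sum_div, ← hS] at hsum
  simp only [Finset.sum_const, Finset.card_univ, Fintype.card_fin, nsmul_eq_mul, mul_one] at hsum
  calc _ ≤ 1 / (t : ℝ) * (t / 2 + S / 2) := by gcongr
    _ = 1 / 2 + S / t / 2 := by field_simp
    _ ≤ _ := by gcongr
end
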